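/- For every q ∈ ℕ there exist constants a_q, A_q, B_q, c₂ = c₂(q) > 0 and b_q > 0 such that for every unit vector ξ ∈ S¹ ∩ 𝔠₀ there exist two orthogonal vectors v₁, v₂ ∈ ℤ² with |v₁| = |v₂|, a_q K_ξ^{q+1} ≤ |v₁| ≤ A_q K_ξ^{q+1}, ‖(v₁, v₂)^{−1}‖ ≤ B_q K_ξ^{−q−1} (where (v₁,v₂) is the 2×2 matrix with columns v₁, v₂ and ‖·‖ is the operator norm), such that for every η ∈ B(ξ, c₂ K_ξ^{−q−2}) one has |h_q(η, v₁, v₂)| ≥ b_q K_ξ^{2q²+6q+2}. -/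

import Mathlib

open Real Set

noncomputable def gfun (t : ℝ) : ℝ := (Real.sqrt (1 - t^2) - t * Real.arccos t) / Real.pi

noncomputable def Kcurv (t : ℝ) : ℝ :=
  deriv (deriv gfun) t / (1 + (deriv gfun t)^2) ^ ((3:ℝ)/2)

def cone0 : Set (ℝ × ℝ) := {x | 0 < x.1 ∧ 0 < x.2 ∧ 1 < x.2 / x.1}

noncomputable def tpar (ξ : ℝ × ℝ) : ℝ := Real.cos (Real.pi * ξ.1 / ξ.2)

noncomputable def Kxi (ξ : ℝ × ℝ) : ℝ := Kcurv (tpar ξ)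

noncomputable def xpt (ξ : ℝ × ℝ) : ℝ × ℝ := (tpar ξ, gfun (tpar ξ))

noncomputable def Hfun (ξ : ℝ × ℝ) : ℝ := ξ.1 * (xpt ξ).1 + ξ.2 * (xpt ξ).2

noncomputable def enorm2 (x : ℝ × ℝ) : ℝ := Real.sqrt (x.1^2 + x.2^2)

noncomputable def pd1 (f : ℝ × ℝ → ℝ) : ℝ × ℝ → ℝ := fun x => fderiv ℝ f x (1, 0)
noncomputable def pd2 (f : ℝ × ℝ → ℝ) : ℝ × ℝ → ℝ := fun x => fderiv ℝ f x (0, 1)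

/-- `g_{i,j}(y, v₁, v₂) = ∂^{q+2} F / (∂u₁ ∂u_i ∂u_j ∂u₂^{q-1}) (0,0)`
for `F(u₁,u₂) = H(y + u₁ v₁ + u₂ v₂)`. -/
noncomputable def gij (q : ℕ) (y v₁ v₂ : ℝ × ℝ) (i j : Fin 2) : ℝ :=
  pd1 ((if i = 0 then pd1 else pd2)
    ((if j = 0 then pd1 else pd2)
      (pd2^[q-1] (fun u : ℝ × ℝ => Hfun (y + u.1 • v₁ + u.2 • v₂))))) (0, 0)

noncomputable def hq (q : ℕ) (y v₁ v₂ : ℝ × ℝ) : ℝ :=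
  gij q y v₁ v₂ 0 0 * gij q y v₁ v₂ 1 1 - gij q y v₁ v₂ 0 1 * gij q y v₁ v₂ 1 0


abbrev EE := ℝ × ℝ

noncomputable def rotL : EE →L[ℝ] EE :=
  (-(ContinuousLinearMap.snd ℝ ℝ ℝ)).prod (ContinuousLinearMap.fst ℝ ℝ ℝ)

noncomputable def idL : EE →L[ℝ] EE := ContinuousLinearMap.id ℝ EE

def Om : Set (EE × EE) := {p | 0 < p.1.2}

noncomputable def DD (A : EE →L[ℝ] EE) (f : EE × EE → ℝ) : EE × EE → ℝ :=
  fun p => fderiv ℝ f p (A p.2, 0)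

def Sm (f : EE × EE → ℝ) : Prop := ∀ n : ℕ, ContDiffOn ℝ n f Om

lemma Om_open : IsOpen Om := isOpen_lt continuous_const (by fun_prop)

lemma Sm.diffAt {f : EE × EE → ℝ} (hf : Sm f) {p : EE × EE} (hp : p ∈ Om) :
    DifferentiableAt ℝ f p :=
  ((hf 1).differentiableOn (by norm_num)).differentiableAt (Om_open.mem_nhds hp)

lemma Sm.fderivOn {f : EE × EE → ℝ} (hf : Sm f) (n : ℕ) : ContDiffOn ℝ n (fderiv ℝ f) Om :=
  (hf (n+1)).fderiv_of_isOpen Om_open (by norm_cast)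

lemma Sm.DD {f : EE × EE → ℝ} (hf : Sm f) (A : EE →L[ℝ] EE) : Sm (DD A f) := by
  intro n
  refine (hf.fderivOn n).clm_apply ?_
  exact ContDiff.contDiffOn (by fun_prop)

lemma Sm.DDiter {f : EE × EE → ℝ} (hf : Sm f) (A : EE →L[ℝ] EE) (n : ℕ) :
    Sm ((_root_.DD A)^[n] f) := by
  induction n with
  | zero => exact hf
  | succ n ih => rw [Function.iterate_succ_apply']; exact ih.DD A

lemma DD_congr {f g : EE × EE → ℝ} (h : EqOn f g Om) (A : EE →L[ℝ] EE) :
    EqOn (DD A f) (DD A g) Om := by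
  intro p hp
  have : f =ᶠ[nhds p] g := by
    filter_upwards [Om_open.mem_nhds hp] with x hx using h hx
  simp only [DD, this.fderiv_eq]

lemma DD_comm {f : EE × EE → ℝ} (hf : Sm f) (A B : EE →L[ℝ] EE) :
    EqOn (DD A (DD B f)) (DD B (DD A f)) Om := by
  intro p hp
  have key : ∀ A B : EE →L[ℝ] EE, DD A (DD B f) p =
      fderiv ℝ (fderiv ℝ f) p (A p.2, 0) (B p.2, 0) := by
    intro A B
    have h1 : DifferentiableAt ℝ (fderiv ℝ f) p :=
      ((hf.fderivOn 1).differentiableOn (by norm_num)).differentiableAt (Om_open.mem_nhds hp)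
    let T : EE × EE →L[ℝ] EE × EE :=
      (B.comp (ContinuousLinearMap.snd ℝ EE EE)).prod 0
    have h2 : HasFDerivAt (fun p => fderiv ℝ f p (T p)) _ p := h1.hasFDerivAt.clm_apply T.hasFDerivAt
    have h3 : DD B f = fun p => fderiv ℝ f p (T p) := by
      funext p; simp [DD, T]
    rw [h3]; unfold DD; rw [h2.fderiv]
    have hz : ((0, 0) : EE × EE) = 0 := rfl
    simp [T, hz]
  rw [key, key]
  have hs : IsSymmSndFDerivAt ℝ f p :=
    ((hf 2).contDiffAt (Om_open.mem_nhds hp)).isSymmSndFDerivAt (by simp)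
  exact hs.eq _ _

lemma DD_iter_comm {f : EE × EE → ℝ} (hf : Sm f) (A B : EE →L[ℝ] EE) (n : ℕ) :
    EqOn (DD A ((DD B)^[n] f)) ((DD B)^[n] (DD A f)) Om := by
  induction n with
  | zero => intro p hp; rfl
  | succ n ih =>
    intro p hp
    rw [Function.iterate_succ_apply', Function.iterate_succ_apply']
    rw [DD_comm (hf.DDiter B n) A B hp]
    exact DD_congr ih B hp

def Hm (k j : ℤ) (f : EE × EE → ℝ) : Prop :=
  ∀ c d : ℝ, 0 < c → 0 < d → ∀ p ∈ Om, f (c • p.1, d • p.2) = c ^ k * d ^ j * f p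

lemma scale_mem {c d : ℝ} (hc : 0 < c) {p : EE × EE} (hp : p ∈ Om) :
    ((c • p.1, d • p.2) : EE × EE) ∈ Om := by
  simp only [Om, Set.mem_ofPred_eq] at *
  exact mul_pos hc hp

lemma Hm.DD {f : EE × EE → ℝ} (hf : Sm f) {k j : ℤ} (h : Hm k j f) (A : EE →L[ℝ] EE) :
    Hm (k-1) (j+1) (DD A f) := by
  intro c d hc hd p hp
  let S : EE × EE →L[ℝ] EE × EE :=
    (c • ContinuousLinearMap.fst ℝ EE EE).prod (d • ContinuousLinearMap.snd ℝ EE EE)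
  have hS : ∀ p, S p = (c • p.1, d • p.2) := fun p => rfl
  have hev : (fun p => f (S p)) =ᶠ[nhds p] fun p => (c^k*d^j) * f p := by
    filter_upwards [Om_open.mem_nhds hp] with x hx using h c d hc hd x hx
  have h1 : HasFDerivAt (fun p => f (S p)) _ p :=
    HasFDerivAt.comp p (hf.diffAt (p := S p) (scale_mem hc hp)).hasFDerivAt S.hasFDerivAt
  have h2 : HasFDerivAt (fun p => (c^k*d^j) * f p) _ p := (hf.diffAt hp).hasFDerivAt.const_mul _
  have h3 := h1.unique (h2.congr_of_eventuallyEq hev)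
  have h4 := congrArg (fun T => T (A p.2, 0)) h3
  simp only [ContinuousLinearMap.comp_apply, hS, _root_.smul_apply, smul_zero,
    smul_eq_mul] at h4
  simp only [_root_.DD, map_smul]
  have h5 : ((d • A p.2, (0:EE)) : EE × EE) = (d / c) • (c • A p.2, (0:EE)) := by
    simp only [Prod.smul_mk, smul_zero, smul_smul]
    rw [div_mul_cancel₀ _ hc.ne']
  rw [h5, map_smul, h4, zpow_sub_one₀ hc.ne', zpow_add_one₀ hd.ne', smul_eq_mul]
  field_simp

lemma Hm.DDiter {f : EE × EE → ℝ} (hf : Sm f) {k j : ℤ} (h : Hm k j f) (A : EE →L[ℝ] EE) (n : ℕ) :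
    Hm (k-n) (j+n) ((_root_.DD A)^[n] f) := by
  induction n with
  | zero => simpa using h
  | succ n ih =>
    rw [Function.iterate_succ_apply']
    have := Hm.DD (hf.DDiter A n) ih A
    push_cast
    convert this using 1 <;> ring

lemma euler {f : EE × EE → ℝ} (hf : Sm f) {k j : ℤ} (h : Hm k j f) {w : EE} (hw : (w, w) ∈ Om) :
    DD idL f (w, w) = k * f (w, w) := by
  have h1 : HasDerivAt (fun t : ℝ => ((t • w, w) : EE × EE)) ((1:ℝ) • w, 0) 1 :=
    ((hasDerivAt_id (1:ℝ)).smul_const w).prodMk (hasDerivAt_const _ _)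
  have h0 : (((1:ℝ) • w, w) : EE × EE) = (w, w) := by simp
  have h2 : HasDerivAt (fun t : ℝ => f (t • w, w)) (fderiv ℝ f (w, w) ((1:ℝ) • w, 0)) 1 := by
    have := (hf.diffAt hw).hasFDerivAt
    rw [← h0] at this
    have h3 := this.comp_hasDerivAt (1:ℝ) h1
    rw [h0] at h3
    exact h3
  have h4 : HasDerivAt (fun t : ℝ => t ^ k * f (w, w)) _ 1 :=
    (hasDerivAt_zpow k 1 (Or.inl one_ne_zero)).mul_const _
  have hev : (fun t : ℝ => f (t • w, w)) =ᶠ[nhds 1] fun t : ℝ => t ^ k * f (w, w) := by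
    filter_upwards [lt_mem_nhds (show (0:ℝ) < 1 by norm_num)] with t ht
    have := h t 1 ht one_pos (w, w) hw
    simpa using this
  have := h2.unique (h4.congr_of_eventuallyEq hev)
  simpa [DD, idL] using this

lemma euler_iter {f : EE × EE → ℝ} (hf : Sm f) {k j : ℤ} (h : Hm k j f) {w : EE}
    (hw : (w, w) ∈ Om) (n : ℕ) :
    (DD idL)^[n] f (w, w) = (∏ i ∈ Finset.range n, ((k:ℝ) - i)) * f (w, w) := by
  induction n with
  | zero => simp
  | succ n ih =>
    rw [Function.iterate_succ_apply', euler (hf.DDiter _ n) (Hm.DDiter hf h _ n) hw, ih,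
      Finset.prod_range_succ]
    push_cast; ring

lemma prod_ge (n : ℕ) : 1 ≤ |∏ i ∈ Finset.range n, ((((-1:ℤ)):ℝ) - i)| := by
  induction n with
  | zero => simp
  | succ n ih =>
    rw [Finset.prod_range_succ, abs_mul]
    have : (1:ℝ) ≤ |((-1:ℤ):ℝ) - n| := by
      rw [abs_of_neg] <;> push_cast <;> have := Nat.cast_nonneg (α := ℝ) n <;> linarith
    nlinarith

/-- the smooth model -/
noncomputable def Ht (p : EE × EE) : ℝ := p.1.2 / π * Real.sin (π * p.1.1 / p.1.2)

lemma Ht_sm : Sm Ht := by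
  intro n
  unfold Ht
  have h1 : ContDiffOn ℝ n (fun p : EE × EE => π * p.1.1 / p.1.2) Om := by
    apply ContDiffOn.div
    · exact ContDiff.contDiffOn (by fun_prop)
    · exact ContDiff.contDiffOn (by fun_prop)
    · intro x hx; exact (ne_of_gt hx)
  exact ContDiffOn.mul (ContDiff.contDiffOn (by fun_prop)) (Real.contDiff_sin.comp_contDiffOn h1)

lemma Ht_hm : Hm 1 0 Ht := by
  intro c d hc hd p hp
  have hp' : 0 < p.1.2 := hp
  have : π * (c * p.1.1) / (c * p.1.2) = π * p.1.1 / p.1.2 := by field_simp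
  simp only [Ht, Prod.smul_fst, Prod.smul_snd, smul_eq_mul, this]
  simp; ring

lemma DD_line {f : EE × EE → ℝ} {p : EE × EE} (hf : DifferentiableAt ℝ f p) (A : EE →L[ℝ] EE) {l : ℝ}
    (h : HasDerivAt (fun t : ℝ => f (p.1 + t • A p.2, p.2)) l 0) : DD A f p = l := by
  have h1 : HasDerivAt (fun t : ℝ => ((p.1 + t • A p.2, p.2) : EE × EE)) ((1:ℝ) • A p.2, 0) 0 :=
    (((hasDerivAt_id (0:ℝ)).smul_const (A p.2)).const_add p.1).prodMk (hasDerivAt_const _ _)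
  have h0 : ((p.1 + (0:ℝ) • A p.2, p.2) : EE × EE) = p := by simp
  have := hf.hasFDerivAt
  rw [← h0] at this
  have h3 := this.comp_hasDerivAt (0:ℝ) h1
  rw [h0] at h3
  have := h3.unique h
  simpa [DD] using this

noncomputable def Ht1 (p : EE × EE) : ℝ := -p.2.2 * Real.cos (π * p.1.1 / p.1.2) +
  p.2.1 * (Real.sin (π * p.1.1 / p.1.2) / π - p.1.1 / p.1.2 * Real.cos (π * p.1.1 / p.1.2))

lemma rot1 (w : EE) : (rotL w).1 = -w.2 := rfl
lemma rot2 (w : EE) : (rotL w).2 = w.1 := rfl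

lemma line1 (p : EE × EE) : HasDerivAt (fun t : ℝ => p.1.1 + t * -p.2.2) (-p.2.2) 0 := by
  simpa using ((hasDerivAt_id (0:ℝ)).mul_const (-p.2.2)).const_add p.1.1
lemma line2 (p : EE × EE) : HasDerivAt (fun t : ℝ => p.1.2 + t * p.2.1) (p.2.1) 0 := by
  simpa using ((hasDerivAt_id (0:ℝ)).mul_const (p.2.1)).const_add p.1.2

lemma DD_Ht : EqOn (DD rotL Ht) Ht1 Om := by
  intro p hp
  have hp' : p.1.2 ≠ 0 := ne_of_gt hp
  refine DD_line (Ht_sm.diffAt hp) rotL ?_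
  simp only [Ht, Prod.fst_add, Prod.snd_add, Prod.smul_fst, Prod.smul_snd, rot1, rot2, smul_eq_mul]
  have hz : p.1.2 + 0 * p.2.1 ≠ 0 := by simpa using hp'
  have := ((line2 p).div_const π).mul ((((line1 p).const_mul π).div (line2 p) hz).sin)
  refine this.congr_deriv ?_
  simp only [Ht1, zero_mul, add_zero, Pi.div_apply]
  have := Real.pi_ne_zero
  field_simp
  ring

lemma DDD_Ht {w : EE} (hw : (w,w) ∈ Om) : DD rotL (DD rotL Ht) (w, w) =
    - π * Real.sin (π * w.1 / w.2) * (w.1^2 + w.2^2)^2 / w.2^3 := by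
  rw [DD_congr DD_Ht rotL hw]
  have hd : DifferentiableAt ℝ Ht1 (w,w) := by
    have := (Ht_sm.DD rotL).diffAt hw
    refine this.congr_of_eventuallyEq ?_
    filter_upwards [Om_open.mem_nhds hw] with x hx using (DD_Ht hx).symm
  have hp' : w.2 ≠ 0 := ne_of_gt hw
  refine DD_line hd rotL ?_
  simp only [Ht1, Prod.fst_add, Prod.snd_add, Prod.smul_fst, Prod.smul_snd, rot1, rot2, smul_eq_mul]
  have hz : w.2 + 0 * w.1 ≠ 0 := by simpa using hp'
  have l1 := line1 (w,w)
  have l2 := line2 (w,w)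
  simp only at l1 l2
  have q1 := ((l1.const_mul π).div l2 hz)
  have := (q1.cos.const_mul (-w.2)).add (((q1.sin.div_const π).sub ((l1.div l2 hz).mul q1.cos)).const_mul w.1)
  refine this.congr_deriv ?_
  simp only [zero_mul, add_zero, Pi.div_apply]
  have := Real.pi_ne_zero
  field_simp
  ring

lemma cone_iff (x : EE) : x ∈ cone0 ↔ 0 < x.1 ∧ 0 < x.2 ∧ x.1 < x.2 := by
  unfold cone0
  simp only [Set.mem_ofPred_eq]
  constructor
  · rintro ⟨a, b, c⟩; exact ⟨a, b, by rwa [one_lt_div a] at c⟩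
  · rintro ⟨a, b, c⟩; exact ⟨a, b, by rwa [one_lt_div a]⟩

lemma cone_open : IsOpen cone0 := by
  have : cone0 = {x : EE | 0 < x.1} ∩ ({x : EE | 0 < x.2} ∩ {x : EE | x.1 < x.2}) := by
    ext x; rw [cone_iff]; rfl
  rw [this]
  exact (isOpen_lt continuous_const continuous_fst).inter
    ((isOpen_lt continuous_const continuous_snd).inter (isOpen_lt continuous_fst continuous_snd))

lemma theta_mem {x : EE} (hx : x ∈ cone0) : 0 < π * x.1 / x.2 ∧ π * x.1 / x.2 < π := by
  rw [cone_iff] at hx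
  obtain ⟨a, b, c⟩ := hx
  have := Real.pi_pos
  refine ⟨by positivity, ?_⟩
  rw [div_lt_iff₀ b]; nlinarith

lemma Hfun_eq {x : EE} (hx : x ∈ cone0) (w : EE) : Hfun x = Ht (x, w) := by
  obtain ⟨h1, h2⟩ := theta_mem hx
  rw [cone_iff] at hx
  have hb : x.2 ≠ 0 := hx.2.1.ne'
  have hs := (Real.sin_pos_of_pos_of_lt_pi h1 h2).le
  simp only [Hfun, xpt, tpar, gfun, Ht]
  rw [← Real.sin_sq_add_cos_sq (π * x.1 / x.2), add_sub_cancel_right, Real.sqrt_sq hs,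
    Real.arccos_cos h1.le h2.le]
  have := Real.pi_ne_zero
  field_simp
  ring

def Rlt (y w : EE) (f : EE × EE → ℝ) (G : EE → ℝ) : Prop :=
  ∀ u : EE, y + u.1 • rotL w + u.2 • w ∈ cone0 → G u = f (y + u.1 • rotL w + u.2 • w, w)

lemma rel_fderiv {y w : EE} {f : EE × EE → ℝ} {G : EE → ℝ} (hf : Sm f) (h : Rlt y w f G)
    (u : EE) (hu : y + u.1 • rotL w + u.2 • w ∈ cone0) (e : EE) :
    fderiv ℝ G u e = fderiv ℝ f (y + u.1 • rotL w + u.2 • w, w) (e.1 • rotL w + e.2 • w, 0) := by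
  let T : EE →L[ℝ] EE := (ContinuousLinearMap.fst ℝ ℝ ℝ).smulRight (rotL w) +
    (ContinuousLinearMap.snd ℝ ℝ ℝ).smulRight w
  have hT : ∀ u : EE, y + u.1 • rotL w + u.2 • w = y + T u := by
    intro u; simp [T, add_assoc]
  have h1 : HasFDerivAt (fun u : EE => ((y + T u, w) : EE × EE)) (T.prod 0) u :=
    (T.hasFDerivAt.const_add y).prodMk (hasFDerivAt_const _ _)
  have hev : G =ᶠ[nhds u] fun u => f (y + T u, w) := by
    have hc : Continuous fun u : EE => y + T u := by fun_prop
    rw [hT] at hu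
    filter_upwards [(cone_open.preimage hc).mem_nhds hu] with x hx
    have := h x
    rw [hT] at this
    exact this hx
  have hm : ((y + T u, w) : EE × EE) ∈ Om := by
    rw [hT, cone_iff] at hu; exact hu.2.1
  have h2 : HasFDerivAt (fun u => f (y + T u, w)) _ u :=
    HasFDerivAt.comp u (hf.diffAt hm).hasFDerivAt h1
  rw [hev.fderiv_eq, h2.fderiv, hT]
  have : e.1 • rotL w + e.2 • w = T e := by simp [T]
  rw [this]; rfl

lemma Rlt.pd1 {y w : EE} {f : EE × EE → ℝ} {G : EE → ℝ} (hf : Sm f) (h : Rlt y w f G) :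
    Rlt y w (DD rotL f) (pd1 G) := by
  intro u hu
  simp [_root_.pd1, DD, rel_fderiv hf h u hu]

lemma Rlt.pd2 {y w : EE} {f : EE × EE → ℝ} {G : EE → ℝ} (hf : Sm f) (h : Rlt y w f G) :
    Rlt y w (DD idL f) (pd2 G) := by
  intro u hu
  simp [_root_.pd2, DD, rel_fderiv hf h u hu, idL]

lemma Rlt.pd2iter {y w : EE} {f : EE × EE → ℝ} {G : EE → ℝ} (hf : Sm f) (h : Rlt y w f G) (n : ℕ) :
    Rlt y w ((DD idL)^[n] f) (_root_.pd2^[n] G) := by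
  induction n with
  | zero => exact h
  | succ n ih =>
    rw [Function.iterate_succ_apply', Function.iterate_succ_apply']
    exact ih.pd2 (hf.DDiter _ n)

noncomputable def base (m : ℕ) : EE × EE → ℝ := (DD idL)^[m] Ht

noncomputable def ht (m : ℕ) (p : EE × EE) : ℝ :=
  DD rotL (DD rotL (DD rotL (base m))) p * DD rotL (DD idL (DD idL (base m))) p -
  DD rotL (DD rotL (DD idL (base m))) p * DD rotL (DD idL (DD rotL (base m))) p

lemma base_sm (m : ℕ) : Sm (base m) := Ht_sm.DDiter _ m

lemma hq_eq (m : ℕ) {y : EE} (hy : y ∈ cone0) (w : EE) : hq (m+1) y (rotL w) w = ht m (y, w) := by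
  have h0 : Rlt y w (base m)
      (pd2^[m] (fun u : ℝ × ℝ => Hfun (y + u.1 • rotL w + u.2 • w))) := by
    refine Rlt.pd2iter Ht_sm ?_ m
    intro u hu
    exact Hfun_eq hu w
  have hs := base_sm m
  have hz : y + ((0,0):EE).1 • rotL w + ((0,0):EE).2 • w = y := by simp
  have h00 := ((h0.pd1 hs).pd1 (hs.DD _)).pd1 ((hs.DD _).DD _) (0,0) (by rwa [hz])
  have h01 := ((h0.pd2 hs).pd1 (hs.DD _)).pd1 ((hs.DD _).DD _) (0,0) (by rwa [hz])
  have h10 := ((h0.pd1 hs).pd2 (hs.DD _)).pd1 ((hs.DD _).DD _) (0,0) (by rwa [hz])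
  have h11 := ((h0.pd2 hs).pd2 (hs.DD _)).pd1 ((hs.DD _).DD _) (0,0) (by rwa [hz])
  rw [hz] at h00 h01 h10 h11
  simp only [hq, gij, Nat.add_sub_cancel, if_true, one_ne_zero, if_false, ht, h00, h01, h10, h11]

lemma ht_sm (m : ℕ) : Sm (ht m) := by
  intro n
  have hs := base_sm m
  exact ((((hs.DD _).DD _).DD _ n).mul (((hs.DD _).DD _).DD _ n)).sub
    ((((hs.DD _).DD _).DD _ n).mul (((hs.DD _).DD _).DD _ n))

lemma ht_scale (m : ℕ) {d : ℝ} (hd : 0 < d) {y : EE} (hy : y ∈ cone0) (w : EE) :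
    ht m (y, d • w) = d ^ (2 * m + 6) * ht m (y, w) := by
  have hs := base_sm m
  have h0 : Hm (1 - m) (0 + m) (base m) := Ht_hm.DDiter Ht_sm idL m
  have hm : (y, w) ∈ Om := ((cone_iff y).1 hy).2.1
  have key : ∀ A B C : EE →L[ℝ] EE, DD A (DD B (DD C (base m))) (y, d • w) =
      d ^ (m + 3) * DD A (DD B (DD C (base m))) (y, w) := by
    intro A B C
    have := ((h0.DD hs C).DD (hs.DD C) B).DD ((hs.DD C).DD B) A 1 d one_pos hd _ hm
    simp only [one_smul, one_zpow, one_mul] at this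
    rw [this]
    congr 1
    rw [← zpow_natCast]; congr 1; push_cast; ring
  simp only [ht, key]
  ring

lemma ht_diag (m : ℕ) {w : EE} (hw : (w, w) ∈ Om) :
    (DD rotL (DD rotL Ht) (w, w))^2 ≤ |ht m (w, w)| := by
  have e1 : EqOn (DD rotL (DD idL (DD idL (base m)))) ((DD idL)^[m+2] (DD rotL Ht)) Om := by
    have := DD_iter_comm Ht_sm rotL idL (m+2)
    rwa [Function.iterate_succ_apply', Function.iterate_succ_apply'] at this
  have e2 : EqOn (DD rotL (DD idL (base m))) ((DD idL)^[m+1] (DD rotL Ht)) Om := by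
    have := DD_iter_comm Ht_sm rotL idL (m+1)
    rwa [Function.iterate_succ_apply'] at this
  have e3 : EqOn (DD idL (DD rotL (base m))) ((DD idL)^[m+1] (DD rotL Ht)) Om := by
    rw [Function.iterate_succ_apply']
    exact DD_congr (DD_iter_comm Ht_sm rotL idL m) _
  have e4 := DD_iter_comm (Ht_sm.DD rotL) rotL idL (m+1)
  have k1 := Ht_hm.DD Ht_sm rotL
  have k2 := k1.DD (Ht_sm.DD rotL) rotL
  have z : DD rotL (DD idL (DD idL (base m))) (w,w) = 0 := by
    rw [e1 hw, euler_iter (Ht_sm.DD _) k1 hw]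
    rw [Finset.prod_eq_zero (i := 0)] <;> simp
  unfold ht
  rw [z, DD_congr e2 _ hw, DD_congr e3 _ hw, e4 hw, euler_iter ((Ht_sm.DD _).DD _) k2 hw]
  have := prod_ge (m+1)
  have hc : ((1 - 1 - 1 : ℤ) : ℝ) = ((-1:ℤ):ℝ) := by norm_num
  rw [hc]
  set c := ∏ i ∈ Finset.range (m+1), ((((-1:ℤ)):ℝ) - i)
  set X := DD rotL (DD rotL Ht) (w, w)
  have hcc : 1 ≤ c^2 := by rw [← sq_abs]; nlinarith
  rw [mul_zero, zero_sub, abs_neg, abs_of_nonneg (by nlinarith [mul_self_nonneg (c * X)])]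
  nlinarith [sq_nonneg X]

lemma ht_lip (m : ℕ) : ∃ L : ℝ, 0 ≤ L ∧ ∀ p p' : EE × EE,
    p ∈ Icc (((-1, 1/2), (-1, -1)) : EE × EE) ((2, 2), (2, 2)) →
    p' ∈ Icc (((-1, 1/2), (-1, -1)) : EE × EE) ((2, 2), (2, 2)) →
    |ht m p - ht m p'| ≤ L * ‖p - p'‖ := by
  have hl : LocallyLipschitzOn (Icc (((-1, 1/2), (-1, -1)) : EE × EE) ((2, 2), (2, 2))) (ht m) := by
    intro p hp
    have hpo : p ∈ Om := by
      have : (1/2:ℝ) ≤ p.1.2 := hp.1.1.2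
      show (0:ℝ) < p.1.2
      linarith
    obtain ⟨K, t, ht, h⟩ := ((ht_sm m 1).contDiffAt (Om_open.mem_nhds hpo)).exists_lipschitzOnWith
    exact ⟨K, t, mem_nhdsWithin_of_mem_nhds ht, h⟩
  obtain ⟨K, hK⟩ := hl.exists_lipschitzOnWith_of_compact isCompact_Icc
  refine ⟨K, K.2, fun p p' hp hp' => ?_⟩
  have := hK.dist_le_mul p hp p' hp'
  rwa [Real.dist_eq, dist_eq_norm] at this

lemma gfun_deriv {t : ℝ} (h1 : -1 < t) (h2 : t < 1) : HasDerivAt gfun (-Real.arccos t / π) t := by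
  have hp : 0 < 1 - t^2 := by nlinarith
  have a := ((((hasDerivAt_id t).pow 2).const_sub 1).sqrt (by simpa using hp.ne'))
  have b := (hasDerivAt_id t).mul (Real.hasDerivAt_arccos h1.ne' h2.ne)
  refine ((a.sub b).div_const π).congr_deriv ?_
  have := Real.sqrt_pos.2 hp
  have := Real.pi_ne_zero
  simp
  field_simp
  ring

lemma gfun_deriv2 {t : ℝ} (h1 : -1 < t) (h2 : t < 1) :
    deriv (deriv gfun) t = 1 / (π * Real.sqrt (1 - t^2)) := by
  have hev : deriv gfun =ᶠ[nhds t] fun t => -Real.arccos t / π := by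
    filter_upwards [Ioo_mem_nhds h1 h2] with x hx using (gfun_deriv hx.1 hx.2).deriv
  have hd : HasDerivAt (fun t => -Real.arccos t / π) _ t :=
    (Real.hasDerivAt_arccos h1.ne' h2.ne).fun_neg.div_const π
  rw [hev.deriv_eq, hd.deriv]
  rw [neg_neg, div_div, mul_comm]

lemma Kxi_eq {ξ : EE} (hξ : ξ ∈ cone0) (hn : ξ.1^2 + ξ.2^2 = 1) :
    Kxi ξ = ξ.2^3 / (π * Real.sin (π * ξ.1 / ξ.2)) := by
  obtain ⟨h1, h2⟩ := theta_mem hξ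
  rw [cone_iff] at hξ
  have hs := (Real.sin_pos_of_pos_of_lt_pi h1 h2)
  have c1 : -1 < Real.cos (π * ξ.1 / ξ.2) := by
    nlinarith [Real.sin_sq_add_cos_sq (π * ξ.1 / ξ.2)]
  have c2 : Real.cos (π * ξ.1 / ξ.2) < 1 := by
    nlinarith [Real.sin_sq_add_cos_sq (π * ξ.1 / ξ.2)]
  have hb := hξ.2.1
  unfold Kxi Kcurv tpar
  rw [gfun_deriv2 c1 c2, (gfun_deriv c1 c2).deriv, Real.arccos_cos h1.le h2.le]
  rw [← Real.sin_sq, Real.sqrt_sq hs.le]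
  have hp := Real.pi_pos
  have e : 1 + (-(π * ξ.1 / ξ.2) / π)^2 = (ξ.2⁻¹)^(2:ℝ) := by
    rw [Real.rpow_two]; field_simp; linarith
  rw [e, ← Real.rpow_mul (by positivity)]
  have : (2:ℝ) * (3/2) = (3:ℕ) := by norm_num
  rw [this, Real.rpow_natCast]
  field_simp

lemma k_facts {ξ : EE} (hξ : ξ ∈ cone0) (hn : ξ.1^2 + ξ.2^2 = 1) :
    0 < Kxi ξ ∧ (Kxi ξ)⁻¹ ≤ 10 ∧ (Kxi ξ)⁻¹ ≤ 40 * ξ.1 ∧ (Kxi ξ)⁻¹ ≤ 40 * (ξ.2 - ξ.1) ∧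
    (DD rotL (DD rotL Ht) (ξ, ξ))^2 = ((Kxi ξ)⁻¹)^2 ∧ 7/10 ≤ ξ.2 ∧ ξ.2 ≤ 1 := by
  obtain ⟨h1, h2⟩ := theta_mem hξ
  have hs := (Real.sin_pos_of_pos_of_lt_pi h1 h2)
  have hc := hξ
  rw [cone_iff] at hξ
  obtain ⟨ha, hb, hab⟩ := hξ
  have hp := Real.pi_pos
  have hp2 := Real.pi_lt_d4
  have b2 : 1/2 ≤ ξ.2^2 := by nlinarith
  have b7 : 7/10 ≤ ξ.2 := by nlinarith
  have b1 : ξ.2 ≤ 1 := by nlinarith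
  have b3 : 35/100 ≤ ξ.2^3 := by nlinarith
  have b4 : 1/4 ≤ ξ.2^4 := by nlinarith
  have bp : π^2 ≤ 10 := by nlinarith
  have hm : (ξ, ξ) ∈ Om := hb
  have hkey : ∀ z : ℝ, 0 < z → Real.sin (π * ξ.1 / ξ.2) ≤ π * z / ξ.2 →
      π * Real.sin (π * ξ.1 / ξ.2) / ξ.2^3 ≤ 40 * z := by
    intro z hz h
    calc π * Real.sin (π * ξ.1 / ξ.2) / ξ.2^3 ≤ π * (π * z / ξ.2) / ξ.2^3 := by gcongr
      _ = π^2 * z / ξ.2^4 := by field_simp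
      _ ≤ 40 * z := by
        rw [div_le_iff₀ (by positivity)]
        nlinarith [mul_le_mul_of_nonneg_right b4 hz.le, mul_le_mul_of_nonneg_right bp hz.le]
  rw [DDD_Ht hm, hn, Kxi_eq hc hn, inv_div]
  refine ⟨by positivity, ?_, ?_, ?_, ?_, b7, b1⟩
  · rw [div_le_iff₀ (by positivity)]
    nlinarith [Real.sin_le_one (π * ξ.1 / ξ.2)]
  · exact hkey _ ha (Real.sin_le h1.le)
  · refine hkey _ (by linarith) ?_
    rw [← Real.sin_pi_sub]
    refine (Real.sin_le (by linarith)).trans (le_of_eq ?_)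
    field_simp
  · ring

lemma comp_le (x : EE) : |x.1| ≤ enorm2 x ∧ |x.2| ≤ enorm2 x :=
  ⟨Real.abs_le_sqrt (by nlinarith [sq_nonneg x.2]), Real.abs_le_sqrt (by nlinarith [sq_nonneg x.1])⟩

lemma inv_bound (a b R : ℝ) (hR : 0 < R) (h : R^2/4 ≤ a^2 + b^2) (x : Fin 2 → ℝ) :
    Real.sqrt (((!![-b, a; a, b])⁻¹.mulVec x 0)^2 + ((!![-b, a; a, b])⁻¹.mulVec x 1)^2) ≤
      2 / R * Real.sqrt ((x 0)^2 + (x 1)^2) := by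
  have hN : 0 < a^2 + b^2 := by nlinarith [sq_pos_of_pos hR]
  have e : ((!![-b, a; a, b])⁻¹.mulVec x 0)^2 + ((!![-b, a; a, b])⁻¹.mulVec x 1)^2 =
      ((x 0)^2 + (x 1)^2) / (a^2 + b^2) := by
    have hN' := hN.ne'
    have hinv : (!![-b, a; a, b])⁻¹ =
        !![-b/(a^2+b^2), a/(a^2+b^2); a/(a^2+b^2), b/(a^2+b^2)] := by
      apply Matrix.inv_eq_right_inv
      ext i j
      fin_cases i <;> fin_cases j <;> simp [Matrix.mul_apply, Fin.sum_univ_two] <;> field_simp <;> ring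
    rw [hinv]
    simp [Matrix.mulVec, dotProduct, Fin.sum_univ_two]
    field_simp
    ring
  rw [e]
  refine Real.sqrt_le_iff.2 ⟨by positivity, ?_⟩
  rw [mul_pow, Real.sq_sqrt (by positivity), div_le_iff₀ hN, div_pow]
  have : 1 ≤ 2^2 / R^2 * (a^2+b^2) := by
    rw [div_mul_eq_mul_div, le_div_iff₀ (by positivity)]; linarith
  nlinarith [add_nonneg (sq_nonneg (x 0)) (sq_nonneg (x 1))]

lemma w_bound (w x : EE) (h : x.1^2 + x.2^2 = 1) (h1 : 0 < x.1) (h2 : 0 < x.2)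
    (g1 : -(1/100) ≤ w.1 - x.1 ∧ w.1 - x.1 ≤ 1/100) (g2 : -(1/100) ≤ w.2 - x.2 ∧ w.2 - x.2 ≤ 1/100) :
    1/4 ≤ w.1^2 + w.2^2 ∧ w.1^2 + w.2^2 ≤ 4 := by
  obtain ⟨w1, w2⟩ := w
  obtain ⟨a, b⟩ := x
  simp only at *
  have ha : a ≤ 1 := by nlinarith
  have hb : b ≤ 1 := by nlinarith
  obtain ⟨d, rfl⟩ : ∃ d, w1 = a + d := ⟨w1 - a, by ring⟩
  obtain ⟨e, rfl⟩ : ∃ e, w2 = b + e := ⟨w2 - b, by ring⟩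
  simp only [add_sub_cancel_left] at *
  have i1 : |a * d| ≤ 1/100 := by
    rw [abs_mul, abs_of_pos h1]; have := abs_le.2 g1; nlinarith [abs_nonneg d]
  have i2 : |b * e| ≤ 1/100 := by
    rw [abs_mul, abs_of_pos h2]; have := abs_le.2 g2; nlinarith [abs_nonneg e]
  rw [abs_le] at i1 i2
  have d2 : d^2 ≤ 1 := by nlinarith
  have e2 : e^2 ≤ 1 := by nlinarith
  constructor <;> nlinarith [sq_nonneg d, sq_nonneg e]

set_option maxHeartbeats 2000000 in
theorem nonvanishing_determinants (q : ℕ) (hq1 : 1 ≤ q) :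
    ∃ a A B c₂ b : ℝ, 0 < a ∧ 0 < A ∧ 0 < B ∧ 0 < c₂ ∧ 0 < b ∧
      ∀ ξ : ℝ × ℝ, ξ ∈ cone0 → enorm2 ξ = 1 →
        ∃ v₁ v₂ : ℤ × ℤ,
          -- the real vectors corresponding to v₁, v₂
          (((v₁.1 : ℝ)) * ((v₂.1 : ℝ)) + ((v₁.2 : ℝ)) * ((v₂.2 : ℝ)) = 0) ∧
          enorm2 ((v₁.1 : ℝ), (v₁.2 : ℝ)) = enorm2 ((v₂.1 : ℝ), (v₂.2 : ℝ)) ∧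
          a * Kxi ξ ^ (q+1) ≤ enorm2 ((v₁.1 : ℝ), (v₁.2 : ℝ)) ∧
          enorm2 ((v₁.1 : ℝ), (v₁.2 : ℝ)) ≤ A * Kxi ξ ^ (q+1) ∧
          -- operator norm bound on the inverse of the matrix with columns v₁, v₂
          (∀ x : Fin 2 → ℝ,
            Real.sqrt (((!![((v₁.1 : ℝ)), ((v₂.1 : ℝ)); ((v₁.2 : ℝ)), ((v₂.2 : ℝ))])⁻¹.mulVec x 0)^2 +
                ((!![((v₁.1 : ℝ)), ((v₂.1 : ℝ)); ((v₁.2 : ℝ)), ((v₂.2 : ℝ))])⁻¹.mulVec x 1)^2) ≤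
              B * (Kxi ξ ^ (q+1))⁻¹ * Real.sqrt ((x 0)^2 + (x 1)^2)) ∧
          ∀ η : ℝ × ℝ, enorm2 (η - ξ) < c₂ * (Kxi ξ ^ (q+2))⁻¹ →
            b * Kxi ξ ^ (2*q^2 + 6*q + 2) ≤
              |hq q η ((v₁.1 : ℝ), (v₁.2 : ℝ)) ((v₂.1 : ℝ), (v₂.2 : ℝ))| := by
  obtain ⟨m, rfl⟩ : ∃ m, q = m + 1 := ⟨q - 1, by omega⟩
  obtain ⟨L, hL0, hL⟩ := ht_lip m
  obtain ⟨ε, hε⟩ : ∃ ε : ℝ, ε = 1 / (100 * 10^(m+3) * (L+1)) := ⟨_, rfl⟩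
  have hεpos : 0 < ε := by rw [hε]; positivity
  have hε1 : ε * 10^(m+3) * (L+1) = 1/100 := by rw [hε]; field_simp
  refine ⟨ε⁻¹/2, 2*ε⁻¹, 2*ε, ε, (ε⁻¹)^(2*m+6)/2, by positivity, by positivity, by positivity,
    hεpos, by positivity, ?_⟩
  intro ξ hξ hn1
  have hn : ξ.1^2 + ξ.2^2 = 1 := by
    unfold enorm2 at hn1
    rwa [Real.sqrt_eq_one] at hn1
  obtain ⟨hK, hk10, hkx, hky, hkd, hξ7, hξ1⟩ := k_facts hξ hn
  obtain ⟨ha, hb, hab⟩ := (cone_iff ξ).1 hξ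
  obtain ⟨K, hKd⟩ : ∃ K, K = Kxi ξ := ⟨_, rfl⟩
  rw [← hKd] at hK hk10 hkx hky hkd ⊢
  obtain ⟨k, hkk⟩ : ∃ k, k = K⁻¹ := ⟨_, rfl⟩
  rw [← hkk] at hk10 hkx hky hkd
  have hk : 0 < k := by rw [hkk]; positivity
  have p0 : k^m ≤ 10^m := by gcongr
  have p1 : k^(m+1) ≤ 10^(m+1) := by gcongr
  have p2 : k^(m+2) ≤ 10^(m+2) := by gcongr
  have P : (0:ℝ) < 10^m := by positivity
  have hεP : ε * 10^m * 1000 ≤ 1/100 := by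
    have : ε * 10^(m+3) * 1 ≤ ε * 10^(m+3) * (L+1) := by gcongr; linarith
    rw [hε1, pow_add] at this; linarith
  have hεL : L * (ε * 10^m * 1000) ≤ 1/100 := by
    have : ε * 10^(m+3) * L ≤ ε * 10^(m+3) * (L+1) := by gcongr; linarith
    rw [hε1, pow_add] at this; linarith
  have hL' : ∀ δ, δ ≤ ε * 10^m * 1000 * k^2 → L * δ ≤ k^2/100 := by
    intro δ hδ
    calc L * δ ≤ L * (ε * 10^m * 1000 * k^2) := by gcongr
      _ = (L * (ε * 10^m * 1000)) * k^2 := by ring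
      _ ≤ 1/100 * k^2 := by gcongr
      _ = _ := by ring
  obtain ⟨R, hR⟩ : ∃ R, R = ε⁻¹ * K^(m+2) := ⟨_, rfl⟩
  have hRpos : 0 < R := by rw [hR]; positivity
  have hRinv : 1 / R = ε * k^(m+2) := by rw [hR, hkk, inv_pow]; field_simp
  have hd2 : 1 / R ≤ ε * 10^m * 1000 * k^2 := by
    rw [hRinv, pow_add]
    have : ε * (k^m * k^2) ≤ ε * (10^m * k^2) := by gcongr
    nlinarith [mul_pos (mul_pos hεpos P) (pow_pos hk 2)]
  have hd1 : 1 / R ≤ 1/100 := by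
    rw [hRinv]
    have : ε * k^(m+2) ≤ ε * 10^(m+2) := by gcongr
    rw [pow_add 10] at this
    nlinarith [mul_pos hεpos P]
  obtain ⟨s, hs⟩ : ∃ s : ℤ, s = ⌊R * ξ.1⌋ := ⟨_, rfl⟩
  obtain ⟨t, ht'⟩ : ∃ t : ℤ, t = ⌊R * ξ.2⌋ := ⟨_, rfl⟩
  have fl : ∀ z : ℝ, |(⌊R*z⌋:ℝ)/R - z| ≤ 1/R := by
    intro z
    have e : (⌊R*z⌋:ℝ)/R - z = ((⌊R*z⌋:ℝ) - R*z) / R := by field_simp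
    rw [e, abs_div, abs_of_pos hRpos]
    gcongr
    rw [abs_le]; constructor <;> linarith [Int.floor_le (R*z), Int.lt_floor_add_one (R*z)]
  have f1 := fl ξ.1
  have f2 := fl ξ.2
  rw [← hs] at f1
  rw [← ht'] at f2
  obtain ⟨w, hw⟩ : ∃ w : EE, w = ((s:ℝ)/R, (t:ℝ)/R) := ⟨_, rfl⟩
  have hw1 : (s:ℝ) = R * w.1 := by rw [hw]; field_simp
  have hw2 : (t:ℝ) = R * w.2 := by rw [hw]; field_simp
  have g1 : |w.1 - ξ.1| ≤ 1/R := by rw [hw]; exact f1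
  have g2 : |w.2 - ξ.2| ≤ 1/R := by rw [hw]; exact f2
  have g1' := abs_le.1 (g1.trans hd1)
  have g2' := abs_le.1 (g2.trans hd1)
  obtain ⟨wlo, whi⟩ := w_bound w ξ hn ha hb g1' g2'
  have nlo : R^2/4 ≤ (s:ℝ)^2 + (t:ℝ)^2 := by
    rw [hw1, hw2]; nlinarith [sq_pos_of_pos hRpos]
  have nhi : (s:ℝ)^2 + (t:ℝ)^2 ≤ (2*R)^2 := by
    rw [hw1, hw2]; nlinarith [sq_pos_of_pos hRpos]
  have exp1 : m + 1 + 1 = m + 2 := rfl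
  have en : enorm2 (((-t:ℤ):ℝ), (s:ℝ)) = Real.sqrt ((s:ℝ)^2 + (t:ℝ)^2) := by
    unfold enorm2; push_cast; congr 1; ring
  refine ⟨(-t, s), (s, t), ?_, ?_, ?_, ?_, ?_, ?_⟩
  · push_cast; ring
  · simp only; rw [en]; rfl
  · simp only; rw [en]
    refine Real.le_sqrt_of_sq_le ?_
    have : ε⁻¹ / 2 * K^(m+1+1) = R/2 := by rw [hR]; ring
    rw [this]; linarith
  · simp only; rw [en]
    have : 2 * ε⁻¹ * K^(m+1+1) = 2*R := by rw [hR]; ring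
    rw [this]
    exact Real.sqrt_le_iff.2 ⟨by positivity, nhi⟩
  · intro x
    have := inv_bound (s:ℝ) (t:ℝ) R hRpos nlo x
    have e : 2 * ε * (K^(m+1+1))⁻¹ = 2 / R := by rw [hR]; field_simp
    rw [e]
    push_cast
    exact this
  · intro η hη
    have hηk : ε * (K^(m+1+2))⁻¹ = ε * k^(m+3) := by rw [hkk, inv_pow]
    rw [hηk] at hη
    have q1 : ε * k^(m+3) ≤ k / 100 := by
      have : ε * (k^(m+2) * k) ≤ ε * (10^(m+2) * k) := by gcongr
      rw [pow_add 10] at this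
      rw [pow_succ k (m+2)]
      nlinarith [mul_pos hεpos P, mul_le_mul_of_nonneg_right hεP hk.le, mul_pos (mul_pos hεpos P) hk]
    have q2 : ε * k^(m+3) ≤ ε * 10^m * 1000 * k^2 := by
      have : ε * (k^(m+1) * k^2) ≤ ε * (10^(m+1) * k^2) := by gcongr
      rw [pow_succ 10 m] at this
      have e : k^(m+3) = k^(m+1) * k^2 := by ring
      rw [e]
      nlinarith [mul_pos (mul_pos hεpos P) (pow_pos hk 2)]
    obtain ⟨c1, c2⟩ := comp_le (η - ξ)
    rw [Prod.fst_sub] at c1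
    rw [Prod.snd_sub] at c2
    have c1' := abs_le.1 (c1.trans (hη.le.trans q1))
    have c2' := abs_le.1 (c2.trans (hη.le.trans q1))
    have hηc : η ∈ cone0 := by
      rw [cone_iff]; refine ⟨?_, ?_, ?_⟩ <;> linarith [c1'.1, c1'.2, c2'.1, c2'.2]
    have hv1 : ((((-t:ℤ):ℝ), (s:ℝ)) : EE) = rotL (R • w) := by
      ext <;> simp [rot1, rot2, hw1, hw2]
    have hv2 : (((s:ℝ), (t:ℝ)) : EE) = R • w := by
      ext <;> simp [hw1, hw2]
    simp only
    rw [hv1, hv2, hq_eq m hηc, ht_scale m hRpos hηc, abs_mul, abs_of_pos (pow_pos hRpos _)]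
    have hin : ((ξ, ξ) : EE × EE) ∈ Icc (((-1, 1/2), (-1, -1)) : EE × EE) ((2, 2), (2, 2)) := by
      refine ⟨⟨⟨?_, ?_⟩, ⟨?_, ?_⟩⟩, ⟨⟨?_, ?_⟩, ⟨?_, ?_⟩⟩⟩ <;> simp only <;> linarith
    have hin2 : ((η, w) : EE × EE) ∈ Icc (((-1, 1/2), (-1, -1)) : EE × EE) ((2, 2), (2, 2)) := by
      refine ⟨⟨⟨?_, ?_⟩, ⟨?_, ?_⟩⟩, ⟨⟨?_, ?_⟩, ⟨?_, ?_⟩⟩⟩ <;> simp only <;>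
        linarith [c1'.1, c1'.2, c2'.1, c2'.2, g1'.1, g1'.2, g2'.1, g2'.2]
    have hlip := hL _ _ hin2 hin
    have hnorm : ‖((η, w) : EE × EE) - (ξ, ξ)‖ ≤ ε * 10^m * 1000 * k^2 := by
      rw [Prod.mk_sub_mk, Prod.norm_def, Prod.norm_def, Prod.norm_def]
      simp only [Prod.fst_sub, Prod.snd_sub, Real.norm_eq_abs]
      refine max_le (max_le ?_ ?_) (max_le ?_ ?_)
      · exact c1.trans (hη.le.trans q2)
      · exact c2.trans (hη.le.trans q2)
      · exact g1.trans hd2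
      · exact g2.trans hd2
    have hdiag := ht_diag m (w := ξ) hb
    rw [hkd] at hdiag
    have hfin : k^2/2 ≤ |ht m (η, w)| := by
      have := hL' _ hnorm
      have h3 := abs_sub_abs_le_abs_sub (ht m (ξ, ξ)) (ht m (η, w))
      rw [abs_sub_comm] at h3
      nlinarith [sq_pos_of_pos hk]
    calc (ε⁻¹)^(2*m+6)/2 * K^(2*(m+1)^2 + 6*(m+1) + 2)
        = R^(2*m+6) * (k^2/2) := by
          have e : K^(2*(m+1)^2 + 6*(m+1) + 2) = K^((m+2)*(2*m+6)) * k^2 := by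
            have : (m+2)*(2*m+6) = (2*(m+1)^2 + 6*(m+1) + 2) + 2 := by ring
            rw [this, pow_add K (2*(m+1)^2 + 6*(m+1) + 2) 2, mul_assoc, ← mul_pow, hkk,
              mul_inv_cancel₀ hK.ne', one_pow, mul_one]
          rw [e, hR, mul_pow, ← pow_mul]; ring
      _ ≤ _ := by gcongr
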